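/- Let α ≥ 0 be an admissible exponent of A and suppose there exists θ > 0 with ‖u‖_α ≤ θ‖G_α u‖_α for all u ∈ c00(α). If n ∈ ℕ and x₀ ∈ E satisfy K(n,x₀) := sup_{m≥n} ‖A(m,n)x₀‖ < ∞, then ‖A(m,n)x₀‖ ≤ (θ/(m−n)) K(n,x₀) for every integer m > n. -/

import Mathlib

open Filter Topology

variable {E : Type*} [NormedAddCommGroup E] [NormedSpace ℝ E] [CompleteSpace E]

/-- `evol A n m` is the evolution operator `A(m,n) = A_{m-1} ∘ ⋯ ∘ A_n`
(the identity if `m ≤ n`). -/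
def evol (A : ℕ → E →L[ℝ] E) (n : ℕ) : ℕ → E →L[ℝ] E
  | 0 => 1
  | m + 1 => if n ≤ m then A m * evol A n m else 1

/-- `α` is an admissible exponent for `A`: there is a positive sequence `M` with
`‖A(m,n)‖ ≤ M n * e^{α (m - n)}` for all `m ≥ n`. -/
def IsAdmissible (A : ℕ → E →L[ℝ] E) (α : ℝ) : Prop :=
  ∃ M : ℕ → ℝ, (∀ n, 0 < M n) ∧
    ∀ m n : ℕ, n ≤ m → ‖evol A n m‖ ≤ M n * Real.exp (α * ((m : ℝ) - (n : ℝ)))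

/-- The norm `‖x‖_{n,α} = sup_{m ≥ n} e^{-α(m-n)} ‖A(m,n) x‖`. -/
noncomputable def nnorm (A : ℕ → E →L[ℝ] E) (α : ℝ) (n : ℕ) (x : E) : ℝ :=
  ⨆ m : Set.Ici n, Real.exp (-α * (((m : ℕ) : ℝ) - (n : ℝ))) * ‖evol A n (m : ℕ) x‖

/-- Membership in `c00(α)`: `u 0 = 0` and `‖u n‖_{n,α} → 0`. -/
def MemC00 (A : ℕ → E →L[ℝ] E) (α : ℝ) (u : ℕ → E) : Prop :=
  u 0 = 0 ∧ Tendsto (fun n => nnorm A α n (u n)) atTop (𝓝 0)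

/-- The norm `‖u‖_α = sup_n ‖u n‖_{n,α}` on `c00(α)`. -/
noncomputable def cnorm (A : ℕ → E →L[ℝ] E) (α : ℝ) (u : ℕ → E) : ℝ :=
  ⨆ n, nnorm A α n (u n)

/-- The evolution map `T`: `(Tu)_0 = 0`, `(Tu)_{n+1} = A_n u_n`. -/
def Tmap (A : ℕ → E →L[ℝ] E) (u : ℕ → E) : ℕ → E
  | 0 => 0
  | m + 1 => A m (u m)

/-- `G = T - Id`. -/
def Gmap (A : ℕ → E →L[ℝ] E) (u : ℕ → E) : ℕ → E :=
  fun n => Tmap A u n - u n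

omit [CompleteSpace E] in
theorem evol_self (A : ℕ → E →L[ℝ] E) (n : ℕ) : evol A n n = 1 := by
  cases n <;> simp [evol]

omit [CompleteSpace E] in
theorem evol_succ (A : ℕ → E →L[ℝ] E) {n m : ℕ} (h : n ≤ m) :
    evol A n (m + 1) = A m * evol A n m := by
  simp [evol, h]

omit [CompleteSpace E] in
theorem evol_evol (A : ℕ → E →L[ℝ] E) {n k m : ℕ} (hnk : n ≤ k) (hkm : k ≤ m) (x : E) :
    evol A k m (evol A n k x) = evol A n m x := by
  induction m, hkm using Nat.le_induction with
  | base => simp [evol_self]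
  | succ m hkm ih => simp [evol_succ A hkm, evol_succ A (hnk.trans hkm), ih]

omit [CompleteSpace E] in
theorem nnorm_zero (A : ℕ → E →L[ℝ] E) (α : ℝ) (n : ℕ) : nnorm A α n 0 = 0 := by
  simp [nnorm]

omit [CompleteSpace E] in
/-- The terms of the supremum defining `nnorm A α k (c • A(k,n) x)` are bounded by `|c| K`, where
`K` bounds the orbit of `x`. -/
theorem exp_mul_norm_evol_smul_le (A : ℕ → E →L[ℝ] E) {α : ℝ} (hα : 0 ≤ α) {n k m : ℕ}
    (hnk : n ≤ k) (hkm : k ≤ m) {x : E} {K : ℝ} (hK : ∀ j, n ≤ j → ‖evol A n j x‖ ≤ K) (c : ℝ) :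
    Real.exp (-α * ((m : ℝ) - (k : ℝ))) * ‖evol A k m (c • evol A n k x)‖ ≤ |c| * K := by
  have hkm' : (k : ℝ) ≤ m := by exact_mod_cast hkm
  have hexp : Real.exp (-α * ((m : ℝ) - (k : ℝ))) ≤ 1 :=
    Real.exp_le_one_iff.2 (by nlinarith)
  rw [map_smul, evol_evol A hnk hkm, norm_smul, Real.norm_eq_abs]
  calc _ ≤ 1 * (|c| * ‖evol A n m x‖) := by gcongr
    _ ≤ |c| * K := by
      rw [one_mul]
      exact mul_le_mul_of_nonneg_left (hK m (hnk.trans hkm)) (abs_nonneg c)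

omit [CompleteSpace E] in
theorem nnorm_smul_evol_le (A : ℕ → E →L[ℝ] E) {α : ℝ} (hα : 0 ≤ α) {n k : ℕ}
    (hnk : n ≤ k) {x : E} {K : ℝ} (hK : ∀ j, n ≤ j → ‖evol A n j x‖ ≤ K) (c : ℝ) :
    nnorm A α k (c • evol A n k x) ≤ |c| * K :=
  haveI : Nonempty (Set.Ici k) := ⟨⟨k, Set.self_mem_Ici⟩⟩
  ciSup_le fun m => exp_mul_norm_evol_smul_le A hα hnk m.2 hK c

omit [CompleteSpace E] in
theorem norm_smul_evol_le_nnorm (A : ℕ → E →L[ℝ] E) {α : ℝ} (hα : 0 ≤ α) {n k : ℕ}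
    (hnk : n ≤ k) {x : E} {K : ℝ} (hK : ∀ j, n ≤ j → ‖evol A n j x‖ ≤ K) (c : ℝ) :
    ‖c • evol A n k x‖ ≤ nnorm A α k (c • evol A n k x) := by
  have hb : BddAbove (Set.range fun m : Set.Ici k =>
      Real.exp (-α * (((m : ℕ) : ℝ) - (k : ℝ))) * ‖evol A k (m : ℕ) (c • evol A n k x)‖) :=
    ⟨|c| * K, by
      rintro _ ⟨m, rfl⟩
      exact exp_mul_norm_evol_smul_le A hα hnk m.2 hK c⟩
  calc _ = Real.exp (-α * ((k : ℝ) - k)) * ‖evol A k k (c • evol A n k x)‖ := by simp [evol_self]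
    _ ≤ _ := le_ciSup hb ⟨k, Set.self_mem_Ici⟩

/-- The tent function of height `m - n` centred at `m`. -/
noncomputable def tent (n m k : ℕ) : ℝ := max 0 (((m : ℝ) - n) - |(k : ℝ) - m|)

theorem tent_nonneg (n m k : ℕ) : 0 ≤ tent n m k := le_max_left _ _

theorem tent_le {n m : ℕ} (h : n ≤ m) (k : ℕ) : tent n m k ≤ (m : ℝ) - n := by
  have : (n : ℝ) ≤ m := by exact_mod_cast h
  exact max_le (by linarith) (by linarith [abs_nonneg ((k : ℝ) - m)])

theorem tent_center {n m : ℕ} (h : n ≤ m) : tent n m m = (m : ℝ) - n := by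
  simp [tent, h]

theorem tent_eq_zero_of_le (n m : ℕ) {k : ℕ} (h : k ≤ n) : tent n m k = 0 := by
  have : (k : ℝ) ≤ n := by exact_mod_cast h
  exact max_eq_left (by linarith [neg_le_abs ((k : ℝ) - m)])

theorem tent_eq_zero_of_ge (n m : ℕ) {k : ℕ} (h : 2 * m ≤ k) : tent n m k = 0 := by
  have h1 : (2 * m : ℝ) ≤ k := by exact_mod_cast h
  have h2 : (0 : ℝ) ≤ n := n.cast_nonneg
  exact max_eq_left (by linarith [le_abs_self ((k : ℝ) - m)])

theorem abs_tent_sub_tent_succ_le (n m k : ℕ) : |tent n m k - tent n m (k + 1)| ≤ 1 := by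
  have h1 := abs_max_sub_max_le_abs (((m : ℝ) - n) - |(k : ℝ) - m|)
    (((m : ℝ) - n) - |((k + 1 : ℕ) : ℝ) - m|) 0
  rw [max_comm _ 0, max_comm _ 0] at h1
  have h2 := abs_abs_sub_abs_le ((((k + 1 : ℕ) : ℝ)) - m) ((k : ℝ) - m)
  calc _ ≤ _ := h1
    _ = |(|((k + 1 : ℕ) : ℝ) - m| - |(k : ℝ) - m|)| := by congr 1; ring
    _ ≤ _ := h2
    _ = 1 := by push_cast; ring_nf; simp

omit [CompleteSpace E] in
theorem Gmap_tent_smul_zero (A : ℕ → E →L[ℝ] E) (n m : ℕ) (x : E) :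
    Gmap A (fun k => tent n m k • evol A n k x) 0 = 0 := by
  simp [Gmap, Tmap, tent_eq_zero_of_le n m n.zero_le]

omit [CompleteSpace E] in
theorem Gmap_tent_smul_succ (A : ℕ → E →L[ℝ] E) (n m k : ℕ) (x : E) :
    Gmap A (fun k => tent n m k • evol A n k x) (k + 1) =
      (tent n m k - tent n m (k + 1)) • evol A n (k + 1) x := by
  rcases le_or_gt n k with h | h
  · simp [Gmap, Tmap, evol_succ A h, sub_smul]
  · simp [Gmap, Tmap, tent_eq_zero_of_le n m h.le, tent_eq_zero_of_le n m (Nat.succ_le_of_lt h)]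

/-- Under the lower bound `‖u‖_α ≤ θ ‖G_α u‖_α` on `c00(α)` with `α ≥ 0`,
if `K(n,x₀) = sup_{m ≥ n} ‖A(m,n) x₀‖ < ∞`, then
`‖A(m,n) x₀‖ ≤ (θ/(m-n)) K(n,x₀)` for every `m > n`. -/
theorem stmt10 (A : ℕ → E →L[ℝ] E) (α : ℝ) (hα : IsAdmissible A α) (hα0 : 0 ≤ α)
    (θ : ℝ) (hθ : 0 < θ)
    (hbelow : ∀ u, MemC00 A α u → cnorm A α u ≤ θ * cnorm A α (Gmap A u))
    (n : ℕ) (x₀ : E)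
    (hbdd : BddAbove (Set.range fun m : Set.Ici n => ‖evol A n (m : ℕ) x₀‖)) :
    ∀ m : ℕ, n < m →
      ‖evol A n m x₀‖ ≤ θ / ((m : ℝ) - (n : ℝ)) *
        ⨆ m' : Set.Ici n, ‖evol A n (m' : ℕ) x₀‖ := by
  intro m hnm
  set K := ⨆ m' : Set.Ici n, ‖evol A n (m' : ℕ) x₀‖
  have hK : ∀ j, n ≤ j → ‖evol A n j x₀‖ ≤ K := fun j hj => le_ciSup hbdd ⟨j, hj⟩
  have hK0 : 0 ≤ K := (norm_nonneg _).trans (hK n le_rfl)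
  have hpos : (0 : ℝ) < (m : ℝ) - n := sub_pos.2 (by exact_mod_cast hnm)
  set u : ℕ → E := fun k => tent n m k • evol A n k x₀ with hu
  have hmem : MemC00 A α u := by
    refine ⟨by simp [hu, tent_eq_zero_of_le n m n.zero_le], ?_⟩
    refine tendsto_const_nhds.congr' ?_
    filter_upwards [eventually_ge_atTop (2 * m)] with k hk
    simp [hu, tent_eq_zero_of_ge n m hk, nnorm_zero]
  have hbound : BddAbove (Set.range fun k => nnorm A α k (u k)) := by
    refine ⟨((m : ℝ) - n) * K, ?_⟩
    rintro _ ⟨k, rfl⟩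
    rcases le_or_gt n k with h | h
    · refine (nnorm_smul_evol_le A hα0 h hK _).trans ?_
      rw [abs_of_nonneg (tent_nonneg n m k)]
      exact mul_le_mul_of_nonneg_right (tent_le hnm.le k) hK0
    · simpa [hu, tent_eq_zero_of_le n m h.le, nnorm_zero] using mul_nonneg hpos.le hK0
  have hlower : ((m : ℝ) - n) * ‖evol A n m x₀‖ ≤ cnorm A α u := by
    have h := (norm_smul_evol_le_nnorm A hα0 hnm.le hK (tent n m m)).trans (le_ciSup hbound m)
    rwa [norm_smul, tent_center hnm.le, Real.norm_of_nonneg hpos.le] at h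
  have hupper : cnorm A α (Gmap A u) ≤ K := by
    refine ciSup_le fun k => ?_
    cases k with
    | zero => rwa [hu, Gmap_tent_smul_zero, nnorm_zero]
    | succ k =>
      rw [hu, Gmap_tent_smul_succ]
      rcases le_or_gt n (k + 1) with h | h
      · refine (nnorm_smul_evol_le A hα0 h hK _).trans ?_
        exact mul_le_of_le_one_left hK0 (abs_tent_sub_tent_succ_le n m k)
      · simpa [tent_eq_zero_of_le n m h.le, tent_eq_zero_of_le n m (k.le_succ.trans h.le),
          nnorm_zero] using hK0
  rw [div_mul_eq_mul_div, le_div_iff₀ hpos, mul_comm]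
  exact hlower.trans ((hbelow u hmem).trans (mul_le_mul_of_nonneg_left hupper hθ.le))
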